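/- Let G[X,Y] be a finite bipartite graph and k ≥ 1 an integer with k·|Y| even; suppose G has no partial parity (g,f)-factor with respect to W = X, where f(v) = 2 for v ∈ X, f(v) = k for v ∈ Y, g(v) = 0 for v ∈ X, g(v) = k for v ∈ Y, and let (A,B) be a biased barrier of G. If D is an odd component of G − (A ∪ B) with |V(D)| ≥ 2, then every vertex x ∈ V(D) having a neighbor in B satisfies x ∈ X and x has a neighbor in D belonging to V(D) ∩ Y. -/

import Mathlib

noncomputable section

/-- `eCnt G S T` is the number of edges of `G` with one endpoint in `S` and the other in `T`
(intended for disjoint `S` and `T`). -/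
def eCnt {V : Type*} (G : SimpleGraph V) (S T : Set V) : ℕ :=
  Nat.card {p : V × V // p.1 ∈ S ∧ p.2 ∈ T ∧ G.Adj p.1 p.2}

/-- The degree of `v` in `G − A` (the induced subgraph on the complement of `A`). -/
def degDel {V : Type*} (G : SimpleGraph V) (A : Set V) (v : V) : ℕ :=
  (G.neighborSet v \ A).ncard

/-- The vertex set of a connected component of an induced subgraph, viewed inside the
ambient vertex set. -/
def compSupp {V : Type*} {G : SimpleGraph V} {s : Set V}
    (c : (G.induce s).ConnectedComponent) : Set V :=
  Subtype.val '' c.supp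

/-- A component `D` of `G − (A ∪ B)` is odd if `Σ_{v ∈ V(D)} f v + e_G(D,B)` is odd. -/
def IsOddComp {V : Type*} (G : SimpleGraph V) (f : V → ℤ) (A B : Set V)
    (c : (G.induce (A ∪ B)ᶜ).ConnectedComponent) : Prop :=
  Odd ((∑ᶠ v ∈ compSupp c, f v) + (eCnt G (compSupp c) B : ℤ))

/-- A component `D` of `G − (A ∪ B)` is even if `Σ_{v ∈ V(D)} f v + e_G(D,B)` is even. -/
def IsEvenComp {V : Type*} (G : SimpleGraph V) (f : V → ℤ) (A B : Set V)
    (c : (G.induce (A ∪ B)ᶜ).ConnectedComponent) : Prop :=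
  Even ((∑ᶠ v ∈ compSupp c, f v) + (eCnt G (compSupp c) B : ℤ))

/-- `h_W(A,B)`: the number of components `D` of `G − (A ∪ B)` such that `g v = f v` for all
`v ∈ V(D) \ W` and `Σ_{v ∈ V(D)} f v + e_G(D,B) ≡ 1 (mod 2)`. -/
def hWnum {V : Type*} (G : SimpleGraph V) (W : Set V) (g f : V → ℤ) (A B : Set V) : ℕ :=
  Nat.card {c : (G.induce (A ∪ B)ᶜ).ConnectedComponent //
    (∀ v ∈ compSupp c \ W, g v = f v) ∧ IsOddComp G f A B c}

/-- `δ_G(A,B) = Σ_{v∈A} f v − Σ_{v∈B} g v + Σ_{v∈B} d_{G−A}(v) − h_W(A,B)`. -/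
def deltaG {V : Type*} (G : SimpleGraph V) (W : Set V) (g f : V → ℤ) (A B : Set V) : ℤ :=
  (∑ᶠ v ∈ A, f v) - (∑ᶠ v ∈ B, g v) + (∑ᶠ v ∈ B, (degDel G A v : ℤ)) -
    (hWnum G W g f A B : ℤ)

/-- `F` is a partial parity `(g,f)`-factor of `G` with respect to `W`: a spanning subgraph with
`g v ≤ d_F v ≤ f v` for all `v` and `d_F v ≡ g v ≡ f v (mod 2)` for `v ∈ W`. -/
def IsPPFactor {V : Type*} (G F : SimpleGraph V) (W : Set V) (g f : V → ℤ) : Prop :=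
  F ≤ G ∧
  (∀ v : V, g v ≤ ((F.neighborSet v).ncard : ℤ) ∧ ((F.neighborSet v).ncard : ℤ) ≤ f v) ∧
  (∀ v ∈ W, Int.ModEq 2 ((F.neighborSet v).ncard : ℤ) (g v) ∧
    Int.ModEq 2 ((F.neighborSet v).ncard : ℤ) (f v))

/-- `(A,B)` is a barrier: a pair of disjoint vertex sets with `δ_G(A,B) < 0`. -/
def IsBarrier {V : Type*} (G : SimpleGraph V) (W : Set V) (g f : V → ℤ) (A B : Set V) : Prop :=
  Disjoint A B ∧ deltaG G W g f A B < 0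

/-- `(A,B)` is a biased barrier: among all barriers, `δ_G(A,B)` is minimum; subject to that,
`|B|` is minimum; subject to that, `|A|` is maximum. -/
def IsBiasedBarrier {V : Type*} (G : SimpleGraph V) (W : Set V) (g f : V → ℤ)
    (A B : Set V) : Prop :=
  IsBarrier G W g f A B ∧
  (∀ A' B' : Set V, IsBarrier G W g f A' B' → deltaG G W g f A B ≤ deltaG G W g f A' B') ∧
  (∀ A' B' : Set V, IsBarrier G W g f A' B' →
    deltaG G W g f A' B' = deltaG G W g f A B → B.ncard ≤ B'.ncard) ∧
  (∀ A' B' : Set V, IsBarrier G W g f A' B' →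
    deltaG G W g f A' B' = deltaG G W g f A B → B'.ncard = B.ncard → A'.ncard ≤ A.ncard)

/-- The function `f` of the `(2,k)`-factor setting: `f = 2` on `X` and `f = k` on `Y`. -/
def fB (X Y : Type*) (k : ℕ) : X ⊕ Y → ℤ := Sum.elim (fun _ => 2) (fun _ => (k : ℤ))

/-- The function `g` of the `(2,k)`-factor setting: `g = 0` on `X` and `g = k` on `Y`. -/
def gB (X Y : Type*) (k : ℕ) : X ⊕ Y → ℤ := Sum.elim (fun _ => 0) (fun _ => (k : ℤ))

theorem mem_compSupp_iff {V : Type*} {G : SimpleGraph V} {s : Set V}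
    {c : (G.induce s).ConnectedComponent} {v : V} :
    v ∈ compSupp c ↔ ∃ h : v ∈ s, (G.induce s).connectedComponentMk ⟨v, h⟩ = c := by
  simp [compSupp]

/-- Component supports are closed under adjacency within the inducing set. -/
theorem mem_compSupp_of_adj {V : Type*} {G : SimpleGraph V} {s : Set V}
    {c : (G.induce s).ConnectedComponent} {v w : V} (hv : v ∈ compSupp c) (hw : w ∈ s)
    (h : G.Adj v w) : w ∈ compSupp c := by
  obtain ⟨hvs, rfl⟩ := mem_compSupp_iff.1 hv
  refine mem_compSupp_iff.2 ⟨hw, ?_⟩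
  have : (G.induce s).Adj ⟨w, hw⟩ ⟨v, hvs⟩ := h.symm
  exact SimpleGraph.ConnectedComponent.sound this.reachable

theorem eq_of_mem_compSupp {V : Type*} {G : SimpleGraph V} {s : Set V}
    {c d : (G.induce s).ConnectedComponent} {v : V} (hc : v ∈ compSupp c)
    (hd : v ∈ compSupp d) : c = d := by
  obtain ⟨_, rfl⟩ := mem_compSupp_iff.1 hc
  obtain ⟨_, rfl⟩ := mem_compSupp_iff.1 hd
  rfl

theorem compSupp_nonempty {V : Type*} {G : SimpleGraph V} {s : Set V}
    (c : (G.induce s).ConnectedComponent) : (compSupp c).Nonempty :=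
  c.nonempty_supp.image _

/-- A component of `G[s]` that has no neighbor in `t \ s` is also a component of `G[t]`. -/
theorem exists_compSupp_eq {V : Type*} {G : SimpleGraph V} {s t : Set V} (hst : s ⊆ t)
    (c : (G.induce s).ConnectedComponent)
    (hc : ∀ v ∈ compSupp c, ∀ w ∈ t \ s, ¬ G.Adj v w) :
    ∃ d : (G.induce t).ConnectedComponent, compSupp d = compSupp c := by
  obtain ⟨v, hv⟩ := compSupp_nonempty c
  obtain ⟨hvs, hvc⟩ := mem_compSupp_iff.1 hv
  refine ⟨(G.induce t).connectedComponentMk ⟨v, hst hvs⟩, Set.Subset.antisymm ?_ ?_⟩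
  · intro w hw
    obtain ⟨hwt, hw⟩ := mem_compSupp_iff.1 hw
    obtain ⟨p⟩ := (SimpleGraph.ConnectedComponent.exact hw).symm
    have key : ∀ {a b : t}, (G.induce t).Walk a b → (a : V) ∈ compSupp c →
        (b : V) ∈ compSupp c := by
      intro a b p
      induction p with
      | nil => exact id
      | @cons a b _ hab _ ih =>
        intro ha
        have hab' : G.Adj a b := hab
        refine ih (mem_compSupp_of_adj ha ?_ hab')
        by_contra hb
        exact hc _ ha _ ⟨b.2, hb⟩ hab'
    exact key p hv
  · intro w hw
    obtain ⟨hws, hwc⟩ := mem_compSupp_iff.1 hw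
    refine mem_compSupp_iff.2 ⟨hst hws, ?_⟩
    have hr := SimpleGraph.ConnectedComponent.exact (hwc.trans hvc.symm)
    exact SimpleGraph.ConnectedComponent.sound
      (hr.map (SimpleGraph.induceHomOfLE G hst).toHom)

/-- Moving a vertex `x` out of `B` destroys at most `d_{G−A}(x)` of the counted components. -/
theorem hWnum_le_degDel_add {V : Type*} [Finite V] (G : SimpleGraph V) (W : Set V)
    (g f : V → ℤ) (A B : Set V) (x : V) :
    hWnum G W g f A B ≤ degDel G A x + hWnum G W g f A (B \ {x}) := by
  have hst : (A ∪ B)ᶜ ⊆ (A ∪ B \ {x})ᶜ :=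
    Set.compl_subset_compl.2 (Set.union_subset_union_right A Set.sdiff_subset)
  have hdest : ∀ c : {c : (G.induce (A ∪ B)ᶜ).ConnectedComponent //
      (∀ v ∈ compSupp c \ W, g v = f v) ∧ IsOddComp G f A B c},
      ∃ z : (G.neighborSet x \ A : Set V) ⊕
        {c : (G.induce (A ∪ B \ {x})ᶜ).ConnectedComponent //
          (∀ v ∈ compSupp c \ W, g v = f v) ∧ IsOddComp G f A (B \ {x}) c},
        match z with
        | Sum.inl u => (u : V) ∈ compSupp c.1
        | Sum.inr d => compSupp d.1 = compSupp c.1 := by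
    rintro ⟨c, hgf, ho⟩
    by_cases hx : ∃ u ∈ compSupp c, G.Adj x u
    · obtain ⟨u, hu, hxu⟩ := hx
      have huA : u ∉ A := fun h => (mem_compSupp_iff.1 hu).1 (Or.inl h)
      exact ⟨Sum.inl ⟨u, hxu, huA⟩, hu⟩
    · push Not at hx
      obtain ⟨d, hd⟩ := exists_compSupp_eq hst c (by
        rintro v hv w ⟨hwt, hws⟩ hvw
        have : w = x := by
          by_contra hne
          simp only [Set.mem_compl_iff, Set.mem_union, Set.mem_sdiff,
            Set.mem_singleton_iff] at hwt hws
          tauto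
        exact hx v hv (this ▸ hvw.symm))
      have he : eCnt G (compSupp c) (B \ {x}) = eCnt G (compSupp c) B := by
        unfold eCnt
        refine Nat.card_congr (Equiv.subtypeEquivRight fun p => ?_)
        refine ⟨fun h => ⟨h.1, h.2.1.1, h.2.2⟩, fun h => ⟨h.1, ⟨h.2.1, ?_⟩, h.2.2⟩⟩
        intro hp
        exact hx _ h.1 ((Set.mem_singleton_iff.1 hp) ▸ h.2.2.symm)
      refine ⟨Sum.inr ⟨d, by rwa [hd], ?_⟩, hd⟩
      unfold IsOddComp at ho ⊢
      rwa [hd, he]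
  choose φ hφ using hdest
  have hinj : Function.Injective φ := by
    intro c d hcd
    have hc := hφ c
    have hd := hφ d
    rw [← hcd] at hd
    apply Subtype.ext
    cases hz : φ c with
    | inl u =>
      rw [hz] at hc hd
      exact eq_of_mem_compSupp hc hd
    | inr e =>
      rw [hz] at hc hd
      obtain ⟨v, hv⟩ := compSupp_nonempty e.1
      have hc' : compSupp e.1 = compSupp c.1 := hc
      have hd' : compSupp e.1 = compSupp d.1 := hd
      exact eq_of_mem_compSupp (hc' ▸ hv) (hd' ▸ hv)
  have := Nat.card_le_card_of_injective φ hinj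
  rwa [Nat.card_sum] at this

/-- Removing from `B` a vertex at which `g` vanishes does not increase `δ_G(A,B)`. -/
theorem deltaG_diff_singleton_le {V : Type*} [Finite V] (G : SimpleGraph V) (W : Set V)
    (g f : V → ℤ) (A B : Set V) {x : V} (hx : x ∈ B) (hg : g x = 0) :
    deltaG G W g f A (B \ {x}) ≤ deltaG G W g f A B := by
  have hsum : ∀ φ : V → ℤ, ∑ᶠ v ∈ B, φ v = φ x + ∑ᶠ v ∈ B \ {x}, φ v := by
    intro φ
    rw [← finsum_mem_insert φ (by simp) (Set.toFinite _), Set.insert_sdiff_singleton,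
      Set.insert_eq_of_mem hx]
  have h := hWnum_le_degDel_add G W g f A B x
  unfold deltaG
  rw [hsum g, hsum fun v => (degDel G A v : ℤ), hg]
  lia

/-- In a biased barrier `(A,B)`, the function `g` has no zero on `B`. -/
theorem IsBiasedBarrier.ne_zero_of_mem {V : Type*} [Finite V] {G : SimpleGraph V} {W : Set V}
    {g f : V → ℤ} {A B : Set V} (h : IsBiasedBarrier G W g f A B) {x : V} (hx : x ∈ B) :
    g x ≠ 0 := by
  intro hg
  obtain ⟨⟨hdisj, hneg⟩, hmin, hB, -⟩ := h
  have hle := deltaG_diff_singleton_le G W g f A B hx hg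
  have hbar : IsBarrier G W g f A (B \ {x}) :=
    ⟨hdisj.mono_right Set.sdiff_subset, hle.trans_lt hneg⟩
  have hcard := hB _ _ hbar (le_antisymm hle (hmin _ _ hbar))
  exact (Set.ncard_sdiff_singleton_lt_of_mem hx).not_ge hcard

/-- A vertex of a component with at least two vertices has a neighbor in that component. -/
theorem exists_adj_of_two_le_ncard_compSupp {V : Type*} {G : SimpleGraph V} {s : Set V}
    {c : (G.induce s).ConnectedComponent} (h2 : 2 ≤ (compSupp c).ncard) {v : V}
    (hv : v ∈ compSupp c) : ∃ u ∈ compSupp c, G.Adj v u := by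
  obtain ⟨w, hw, hne⟩ := Set.exists_ne_of_one_lt_ncard h2 v
  obtain ⟨hvs, hvc⟩ := mem_compSupp_iff.1 hv
  obtain ⟨hws, hwc⟩ := mem_compSupp_iff.1 hw
  obtain ⟨p⟩ := SimpleGraph.ConnectedComponent.exact (hvc.trans hwc.symm)
  cases p with
  | nil => exact absurd rfl hne
  | @cons _ u _ hvu _ =>
    have hvu' : G.Adj v u := hvu
    exact ⟨u, mem_compSupp_of_adj hv u.2 hvu', hvu'⟩

/-- for a biased barrier `(A,B)` and an odd component `D` of `G − (A ∪ B)`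
with `|V(D)| ≥ 2`, every vertex of `D` with a neighbor in `B` lies in `X` and has a neighbor
in `V(D) ∩ Y`. -/
theorem biased_barrier_odd_comp_X_vertex {X Y : Type*} [Fintype X] [Fintype Y]
    (G : SimpleGraph (X ⊕ Y))
    (hX : ∀ x x' : X, ¬ G.Adj (Sum.inl x) (Sum.inl x'))
    (hY : ∀ y y' : Y, ¬ G.Adj (Sum.inr y) (Sum.inr y'))
    (k : ℕ) (hk : 1 ≤ k) (heven : Even (k * Fintype.card Y))
    (hno : ¬ ∃ F : SimpleGraph (X ⊕ Y),
      IsPPFactor G F (Set.range (Sum.inl : X → X ⊕ Y)) (gB X Y k) (fB X Y k))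
    (A B : Set (X ⊕ Y))
    (hAB : IsBiasedBarrier G (Set.range (Sum.inl : X → X ⊕ Y)) (gB X Y k) (fB X Y k) A B)
    (c : (G.induce (A ∪ B)ᶜ).ConnectedComponent)
    (hodd : IsOddComp G (fB X Y k) A B c)
    (h2 : 2 ≤ (compSupp c).ncard)
    (v : X ⊕ Y) (hv : v ∈ compSupp c) (hvB : ∃ b ∈ B, G.Adj v b) :
    v ∈ Set.range (Sum.inl : X → X ⊕ Y) ∧
      ∃ u ∈ compSupp c, u ∈ Set.range (Sum.inr : Y → X ⊕ Y) ∧ G.Adj v u := by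
  obtain ⟨b, hb, hvb⟩ := hvB
  have hbg := hAB.ne_zero_of_mem hb
  cases b with
  | inl x => exact absurd rfl hbg
  | inr y =>
    cases v with
    | inr y' => exact absurd hvb (hY y' y)
    | inl x =>
      obtain ⟨u, hu, hxu⟩ := exists_adj_of_two_le_ncard_compSupp h2 hv
      refine ⟨⟨x, rfl⟩, u, hu, ?_, hxu⟩
      cases u with
      | inl x' => exact absurd hxu (hX x x')
      | inr y' => exact ⟨y', rfl⟩
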